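/- Suppose β ≥ 4/7 and p ∈ [0,1]. Then for every configuration S ∈ 𝒟∖{𝒟₀}, the one-step expected increment of φ₁ for the discrete-time exclusion-voter chain is nonpositive: E_{β,p}[ φ₁(ξ_{t+1}) − φ₁(ξ_t) | ξ_t = S ] ≤ 0, i.e. Σ_{S'∈𝒟} P(S,S') φ₁(S') ≤ φ₁(S), where P denotes the one-step transition kernel of the chain. -/

import Mathlib

open MeasureTheory Filter
open scoped ENNReal NNReal

namespace EV

/-- A configuration of the exclusion-voter model is the finite hybrid-zone word
(`false` = 0, `true` = 1); the full two-sided configuration is `1^∞ w 0^∞`. -/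
abbrev Word := List Bool

/-- Canonical (normalized) words: empty (the ground state `𝒟₀`) or starting with
a `0` and ending with a `1`; these are in bijection with the configuration space `𝒟`. -/
def IsConfig (w : Word) : Prop :=
  w = [] ∨ (w.head? = some false ∧ w.getLast? = some true)

/-- The ground-state Heaviside configuration `𝒟₀ = …111000…`. -/
def groundState : Word := []

/-- Pad a word with one boundary symbol of the adjacent infinite block on each side. -/
def pad (w : Word) : Word := true :: (w ++ [false])

/-- Normalize: strip leading `1`s (they merge into the left infinite block of `1`s)
and trailing `0`s (they merge into the right infinite block of `0`s). -/
def strip (w : Word) : Word :=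
  ((w.dropWhile (· = true)).reverse.dropWhile (· = false)).reverse

def setPair (w : Word) (i : ℕ) (a b : Bool) : Word := (w.set i a).set (i + 1) b

def swapPair (w : Word) (i : ℕ) : Word :=
  setPair w i (w.getD (i + 1) true) (w.getD i true)

/-- Indices of the unlike adjacent pairs (`01` or `10`), read off the padded word. -/
def unlike (w : Word) : List ℕ :=
  (List.range (w.length + 1)).filter
    (fun i => (pad w).getD i true ≠ (pad w).getD (i + 1) true)

/-- One-step transition kernel of the discrete-time exclusion-voter chain with mixing
parameter `β` and exclusion parameter `p`: an unlike adjacent pair is chosen uniformly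
at random; with probability `β` a voter move flips the pair to `00` or `11` (each with
probability `1/2`); with probability `1-β` an exclusion move swaps a `01` with
probability `p` and a `10` with probability `1-p` (otherwise no change). -/
noncomputable def P (β p : ℝ) (w w' : Word) : ℝ :=
  ((unlike w).map (fun i =>
    let a := (pad w).getD i true
    let swapProb := if a then 1 - p else p
    ((unlike w).length : ℝ)⁻¹ *
      (β * (1 / 2) * (if strip (setPair (pad w) i false false) = w' then 1 else 0)
       + β * (1 / 2) * (if strip (setPair (pad w) i true true) = w' then 1 else 0)
       + (1 - β) * swapProb * (if strip (swapPair (pad w) i) = w' then 1 else 0)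
       + (1 - β) * (1 - swapProb) * (if w = w' then 1 else 0)))).sum

/-- `n`-step transition probabilities. -/
noncomputable def Pn (β p : ℝ) : ℕ → Word → Word → ℝ
  | 0 => fun w w' => if w = w' then 1 else 0
  | n + 1 => fun w w' => ∑' z : Word, Pn β p n w z * P β p z w'

/-- `w'` is accessible from `w`: some `n`-step transition probability is positive. -/
def Accessible (β p : ℝ) (w w' : Word) : Prop :=
  ∃ n : ℕ, 0 < n ∧ 0 < Pn β p n w w'

/-- Two states communicate: each is accessible from the other. -/
def Communicate (β p : ℝ) (w w' : Word) : Prop :=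
  Accessible β p w w' ∧ Accessible β p w' w

instance : MeasurableSpace Word := ⊤

/-- `ξ` is (a realization of) the discrete-time exclusion-voter Markov chain with
parameters `(β, p)` under the probability measure `μ`. -/
def IsEVChain (β p : ℝ) {Ω : Type*} [MeasurableSpace Ω] (μ : Measure Ω)
    (ξ : ℕ → Ω → Word) : Prop :=
  (∀ t, Measurable (ξ t)) ∧
  ∀ (t : ℕ) (path : ℕ → Word),
    μ {ω | ∀ i ≤ t + 1, ξ i ω = path i}
      = μ {ω | ∀ i ≤ t, ξ i ω = path i} * ENNReal.ofReal (P β p (path t) (path (t + 1)))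

/-- The relaxation time `τ = min {t ∈ ℕ, t ≥ 1 : ξ_t = 𝒟₀}` (`∞` if there is no such `t`). -/
noncomputable def relaxTime {Ω : Type*} (ξ : ℕ → Ω → Word) (ω : Ω) : ℝ≥0∞ :=
  sInf {r : ℝ≥0∞ | ∃ t : ℕ, 0 < t ∧ ξ t ω = groundState ∧ r = (t : ℝ≥0∞)}

/-- The size `|S|` of the hybrid zone. -/
def hz (w : Word) : ℕ := w.length

/-- The number of blocks `N(S)`: the number of (finite) `1`-blocks of the hybrid zone. -/
def nb (w : Word) : ℕ :=
  ((Finset.range w.length).filter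
    (fun b => w.getD b false = true ∧ (b = 0 ∨ w.getD (b - 1) true = false))).card

/-- Number of `0`s among the first `c` positions of the hybrid zone. -/
def z0 (w : Word) (c : ℕ) : ℕ :=
  ((Finset.range c).filter (fun a => w.getD a true = false)).card

/-- Number of `1`s of the hybrid zone at positions `≥ c`. -/
def o1 (w : Word) (c : ℕ) : ℕ :=
  ((Finset.Ico c w.length).filter (fun b => w.getD b false = true)).card

/-- `f₁(S) = Σᵢ mᵢ Rᵢ = Σᵢ nᵢ Tᵢ`: each `1` contributes the number of `0`s to its left. -/
def f1 (w : Word) : ℕ :=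
  ∑ b ∈ (Finset.range w.length).filter (fun b => w.getD b false = true), z0 w b

/-- `f₂(S) = (1/2)(Σᵢ mᵢ Rᵢ² + Σᵢ nᵢ Tᵢ²)`: each `1` contributes the squared number of
`0`s to its left, each `0` the squared number of `1`s to its right. -/
noncomputable def f2 (w : Word) : ℝ :=
  (1 / 2) *
    ((∑ b ∈ (Finset.range w.length).filter (fun b => w.getD b false = true),
        ((z0 w b : ℝ)) ^ 2)
     + (∑ a ∈ (Finset.range w.length).filter (fun a => w.getD a true = false),
        ((o1 w (a + 1) : ℝ)) ^ 2))

/-- `g(S) = max_{1 ≤ k ≤ N} R_k T_k`: the maximum over the `01`-corners of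
(number of `0`s up to the corner) × (number of `1`s after the corner). -/
def gfun (w : Word) : ℕ :=
  ((Finset.range w.length).filter
    (fun a => w.getD a true = false ∧ w.getD (a + 1) false = true)).sup
    (fun a => z0 w (a + 1) * o1 w (a + 1))

/-- `φ₁(S) = Σᵢ Σ_{j=R_{i-1}+1}^{R_i} Σ_{k=1}^{T_i} 1/(j+k)`: the `j`-th `0` (at position `a`,
so `j = z0 w (a+1)`) contributes `Σ_{k=1}^{T} 1/(j+k)` with `T` the number of `1`s to its right. -/
noncomputable def phi1 (w : Word) : ℝ :=
  ∑ a ∈ (Finset.range w.length).filter (fun a => w.getD a true = false),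
    ∑ k ∈ Finset.Icc 1 (o1 w (a + 1)), (1 : ℝ) / ((z0 w (a + 1) : ℝ) + (k : ℝ))


/-- Number of `1`s of a word. -/
def ones (w : Word) : ℕ := w.count true

/-- Number of `0`s of a word. -/
def zeros (w : Word) : ℕ := w.count false

@[simp] lemma ones_nil : ones [] = 0 := rfl
@[simp] lemma zeros_nil : zeros [] = 0 := rfl
@[simp] lemma ones_true (w : Word) : ones (true :: w) = ones w + 1 := by simp [ones]
@[simp] lemma ones_false (w : Word) : ones (false :: w) = ones w := by simp [ones]
@[simp] lemma zeros_true (w : Word) : zeros (true :: w) = zeros w := by simp [zeros]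
@[simp] lemma zeros_false (w : Word) : zeros (false :: w) = zeros w + 1 := by simp [zeros]
@[simp] lemma ones_append (u v : Word) : ones (u ++ v) = ones u + ones v := by simp [ones]
@[simp] lemma zeros_append (u v : Word) : zeros (u ++ v) = zeros u + zeros v := by simp [zeros]

/-- The row sum `∑_{k=1}^{t} 1/(j+k)`. -/
noncomputable def rowSum (j t : ℕ) : ℝ := ∑ k ∈ Finset.Icc 1 t, (1 : ℝ) / ((j : ℝ) + (k : ℝ))

@[simp] lemma rowSum_zero (j : ℕ) : rowSum j 0 = 0 := by simp [rowSum]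

lemma rowSum_succ (j t : ℕ) : rowSum j (t + 1) = rowSum j t + 1 / ((j : ℝ) + t + 1) := by
  rw [rowSum, Finset.sum_Icc_succ_top (by omega)]
  simp [rowSum, add_assoc]

lemma rowSum_shift (j t : ℕ) :
    rowSum (j + 1) t - rowSum j t = 1 / ((j : ℝ) + t + 1) - 1 / ((j : ℝ) + 1) := by
  induction t with
  | zero => simp
  | succ t ih =>
    rw [rowSum_succ, rowSum_succ]
    push_cast
    have e : (j : ℝ) + 1 + t + 1 = j + (t + 1) + 1 := by ring
    have e' : (j : ℝ) + t + 1 = j + 1 + t := by ring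
    rw [e]
    linarith

/-- The potential of a word preceded by `j` zeros and followed by `t` ones. -/
noncomputable def potential (j : ℕ) : Word → ℕ → ℝ
  | [], _ => 0
  | true :: w, t => potential j w t
  | false :: w, t => rowSum (j + 1) (ones w + t) + potential (j + 1) w t

lemma z0_cons_succ (b : Bool) (w : Word) (c : ℕ) :
    z0 (b :: w) (c + 1) = z0 w c + if b = false then 1 else 0 := by
  simp only [z0, Finset.card_filter]
  rw [Finset.sum_range_succ']
  simp

lemma o1_zero (w : Word) : o1 w 0 = ones w := by
  simp only [o1, Finset.card_filter, Nat.Ico_zero_eq_range]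
  induction w with
  | nil => simp
  | cons b w ih =>
    rw [List.length_cons, Finset.sum_range_succ']
    simp only [List.getD_cons_succ, List.getD_cons_zero]
    rw [ih]
    cases b <;> simp

lemma o1_cons_succ (b : Bool) (w : Word) (c : ℕ) : o1 (b :: w) (c + 1) = o1 w c := by
  simp only [o1, Finset.card_filter, List.length_cons]
  rw [← Finset.sum_Ico_add' _ c w.length 1]
  simp

lemma sum_rows_eq_potential (j : ℕ) (w : Word) :
    (∑ a ∈ (Finset.range w.length).filter (fun a => w.getD a true = false),
      rowSum (j + z0 w (a + 1)) (o1 w (a + 1))) = potential j w 0 := by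
  induction w generalizing j with
  | nil => simp [potential]
  | cons b w ih =>
    rw [Finset.sum_filter, List.length_cons, Finset.sum_range_succ']
    simp only [List.getD_cons_succ, List.getD_cons_zero, z0_cons_succ, o1_cons_succ, o1_zero]
    cases b
    · rw [potential, ← ih, Finset.sum_filter, add_comm]
      simp [z0, add_assoc, add_comm 1]
    · rw [potential, ← ih, Finset.sum_filter]
      simp

lemma phi1_eq_potential (w : Word) : phi1 w = potential 0 w 0 := by
  rw [← sum_rows_eq_potential]
  simp [phi1, rowSum]

lemma potential_append (j : ℕ) (u v : Word) (t : ℕ) :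
    potential j (u ++ v) t = potential j u (ones v + t) + potential (j + zeros u) v t := by
  induction u generalizing j with
  | nil => simp [potential]
  | cons b u ih =>
    cases b
    · simp only [List.cons_append, potential, ih, zeros_false, ones_append]
      rw [add_assoc j 1, add_comm 1, add_assoc (ones u)]
      ring
    · simp [potential, ih]

lemma potential_dropWhile (j : ℕ) (w : Word) (t : ℕ) :
    potential j (w.dropWhile (· = true)) t = potential j w t := by
  induction w with
  | nil => rfl
  | cons b w ih => cases b <;> simp_all [potential]

lemma potential_rdropWhile (j : ℕ) (w : Word) :
    potential j (w.rdropWhile (· = false)) 0 = potential j w 0 := by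
  induction w using List.reverseRecOn with
  | nil => simp
  | append_singleton w b ih =>
    rw [List.rdropWhile_concat]
    cases b
    · rw [if_pos (by simp), ih]
      simp [potential_append, potential]
    · simp

lemma phi1_strip (w : Word) : phi1 (strip w) = phi1 w := by
  rw [phi1_eq_potential, phi1_eq_potential, strip, ← potential_dropWhile 0 w]
  exact potential_rdropWhile 0 _

lemma phi1_pad (w : Word) : phi1 (pad w) = phi1 w := by
  simp [phi1_eq_potential, pad, potential, potential_append]

lemma setPair_append (u v : Word) (a b x y : Bool) :
    setPair (u ++ a :: b :: v) u.length x y = u ++ x :: y :: v := by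
  induction u with
  | nil => rfl
  | cons c u ih => simp_all [setPair]

/-- The weight `1/(s(s+1))` of a step of the boundary path with upper level `s = n + 1`. -/
noncomputable def stepWeight (n : ℕ) : ℝ := 1 / ((n : ℝ) + 1) - 1 / ((n : ℝ) + 2)

lemma inv_sub_inv_add_antitone {x y z : ℝ} (hx : 0 < x) (hxy : x ≤ y) (hz : 0 ≤ z) :
    1 / y - 1 / (y + z) ≤ 1 / x - 1 / (x + z) := by
  have hy : 0 < y := hx.trans_le hxy
  have e : ∀ w : ℝ, 0 < w → 1 / w - 1 / (w + z) = z / (w * (w + z)) := fun w hw => by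
    field_simp
    ring
  rw [e x hx, e y hy]
  gcongr

/-- Total weight of the `0`s of a word preceded by `j` zeros and followed by `t` ones. -/
noncomputable def zeroWeight (j : ℕ) : Word → ℕ → ℝ
  | [], _ => 0
  | true :: w, t => zeroWeight j w t
  | false :: w, t => stepWeight (j + ones w + t) + zeroWeight (j + 1) w t

/-- Total weight of the `1`s of a word preceded by `j` zeros (and followed by no ones). -/
noncomputable def oneWeight (j : ℕ) : Word → ℝ
  | [] => 0
  | true :: w => stepWeight (j + ones w) + oneWeight j w
  | false :: w => oneWeight (j + 1) w

lemma potential_second_difference_right (j : ℕ) (u : Word) (t : ℕ) :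
    potential j u (t + 2) - 2 * potential j u (t + 1) + potential j u t
      = - zeroWeight j u (t + 1) := by
  induction u generalizing j with
  | nil => simp [potential, zeroWeight]
  | cons b u ih =>
    cases b
    · simp only [potential, zeroWeight, stepWeight, ← add_assoc, rowSum_succ]
      have h := ih (j + 1)
      have e : (j : ℝ) + 1 + (ones u + t + 1) + 1 = j + (ones u + t + 1) + 2 := by ring
      have e' : (j : ℝ) + 1 + (ones u + t) + 1 = j + (ones u + t + 1) + 1 := by ring
      push_cast
      simp only [← add_assoc] at h e e' ⊢
      rw [e, e']
      linarith
    · simpa [potential, zeroWeight] using ih j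

lemma potential_second_difference_left (j : ℕ) (v : Word) :
    potential (j + 2) v 0 - 2 * potential (j + 1) v 0 + potential j v 0
      = 1 / ((j : ℝ) + 2) - 1 / ((j : ℝ) + ones v + 2) - oneWeight (j + 1) v := by
  induction v generalizing j with
  | nil => simp [potential, oneWeight]
  | cons b v ih =>
    cases b
    · have h := ih (j + 1)
      have h1 := rowSum_shift (j + 1) (ones v)
      have h2 := rowSum_shift (j + 2) (ones v)
      simp only [potential, oneWeight, ones_false, add_zero]
      push_cast at h h1 h2
      ring_nf at h h1 h2 ⊢
      linarith
    · have h := ih j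
      simp only [potential, oneWeight, ones_true, stepWeight]
      push_cast
      ring_nf at h ⊢
      linarith

/-- The level of the boundary path between the words `u` and `v`. -/
def level (u v : Word) : ℕ := zeros u + ones v

/-- The quantity `C(u, v)`, which only depends on the word `u ++ v`. -/
noncomputable def invariant (u v : Word) : ℝ :=
  zeroWeight 0 u (ones v) + oneWeight (zeros u) v + 1 / ((level u v : ℝ) + 1)

lemma zeroWeight_append (j : ℕ) (u v : Word) (t : ℕ) :
    zeroWeight j (u ++ v) t = zeroWeight j u (ones v + t) + zeroWeight (j + zeros u) v t := by
  induction u generalizing j with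
  | nil => simp [zeroWeight]
  | cons b u ih =>
    cases b
    · simp only [List.cons_append, zeroWeight, ih, zeros_false, ones_append]
      rw [add_assoc j 1, add_comm 1]
      simp only [← add_assoc]
    · simp [zeroWeight, ih]

lemma oneWeight_append_false (j : ℕ) (v : Word) : oneWeight j (v ++ [false]) = oneWeight j v := by
  induction v generalizing j with
  | nil => simp [oneWeight]
  | cons b v ih => cases b <;> simp [oneWeight, ih]

lemma invariant_step (u v : Word) (b : Bool) : invariant u (b :: v) = invariant (u ++ [b]) v := by
  cases b
  · simp only [invariant, level, zeroWeight_append, zeroWeight, oneWeight, stepWeight, ones_false,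
      zeros_append, zeros_false, zeros_nil, ones_nil]
    push_cast
    ring_nf
  · simp only [invariant, level, zeroWeight_append, zeroWeight, oneWeight, stepWeight, ones_true,
      zeros_append, zeros_true, zeros_nil, ones_nil]
    push_cast
    ring_nf

lemma invariant_eq (u v : Word) : invariant u v = invariant [] (u ++ v) := by
  induction u using List.reverseRecOn generalizing v with
  | nil => rfl
  | append_singleton u b ih => rw [← invariant_step, ih]; simp

lemma invariant_pad (w : Word) : invariant [] (pad w) = invariant [] w := by
  rw [pad, invariant_step]
  simp [invariant, level, zeroWeight, oneWeight_append_false]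

lemma voter_increment_valley (u v : Word) :
    phi1 (u ++ false :: false :: v) + phi1 (u ++ true :: true :: v)
        - 2 * phi1 (u ++ true :: false :: v)
      = - invariant [] (u ++ true :: false :: v)
        + 1 / ((level (u ++ [true]) (false :: v) : ℝ) + 1) := by
  rw [show u ++ true :: false :: v = (u ++ [true]) ++ false :: v by simp, ← invariant_eq]
  have h1 := potential_second_difference_right 0 u (ones v)
  have h2 := potential_second_difference_left (zeros u) v
  have h3 := rowSum_shift (zeros u + 1) (ones v)
  simp only [phi1_eq_potential, invariant, level, zeroWeight_append, zeroWeight, oneWeight,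
    potential_append, potential, ones_true, ones_false, ones_nil, zeros_append, zeros_true,
    zeros_nil]
  push_cast at h3 ⊢
  ring_nf at h1 h2 h3 ⊢
  linarith

lemma exclusion_increment_valley (u v : Word) :
    phi1 (u ++ false :: true :: v) - phi1 (u ++ true :: false :: v)
      = 1 / ((level (u ++ [true]) (false :: v) : ℝ) + 2) := by
  simp only [phi1_eq_potential, level, potential_append, potential, ones_true, ones_false,
    zeros_append, zeros_true, zeros_nil, add_zero, rowSum_succ]
  push_cast
  ring_nf

lemma voter_increment_peak (u v : Word) :
    phi1 (u ++ false :: false :: v) + phi1 (u ++ true :: true :: v)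
        - 2 * phi1 (u ++ false :: true :: v)
      = - invariant [] (u ++ false :: true :: v)
        - 1 / ((level (u ++ [false]) (true :: v) : ℝ) + 1) := by
  have h1 := voter_increment_valley u v
  have h2 := exclusion_increment_valley u v
  rw [show u ++ true :: false :: v = (u ++ [true]) ++ false :: v by simp, ← invariant_eq] at h1
  rw [show u ++ false :: true :: v = (u ++ [false]) ++ true :: v by simp, ← invariant_eq]
  simp only [invariant, level, zeroWeight_append, zeroWeight, oneWeight, stepWeight, ones_true,
    ones_false, ones_nil, zeros_append, zeros_false, zeros_true, zeros_nil, List.append_assoc,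
    List.cons_append, List.nil_append] at h1 h2 ⊢
  push_cast at h1 h2 ⊢
  ring_nf at h1 h2 ⊢
  linarith

lemma zeroWeight_lower_bound (j : ℕ) (u : Word) (t : ℕ) :
    1 / ((j : ℝ) + ones u + t + 1) - 1 / ((j : ℝ) + ones u + t + zeros u + 1)
      ≤ zeroWeight j u t := by
  induction u generalizing j with
  | nil => simp [zeroWeight]
  | cons b u ih =>
    cases b
    · have h := ih (j + 1)
      simp only [zeroWeight, ones_false, zeros_false, stepWeight]
      push_cast at h ⊢
      ring_nf at h ⊢
      linarith
    · refine le_trans ?_ (ih j)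
      have h := inv_sub_inv_add_antitone (x := (j : ℝ) + ones u + t + 1)
        (y := (j : ℝ) + ones u + t + 2) (z := zeros u) (by positivity) (by linarith) (by positivity)
      simp only [ones_true, zeros_true]
      push_cast
      ring_nf at h ⊢
      linarith

lemma oneWeight_lower_bound (j : ℕ) (v : Word) :
    1 / ((j : ℝ) + zeros v + 1) - 1 / ((j : ℝ) + zeros v + ones v + 1) ≤ oneWeight j v := by
  induction v generalizing j with
  | nil => simp [oneWeight]
  | cons b v ih =>
    cases b
    · have h := ih (j + 1)
      simp only [oneWeight, ones_false, zeros_false]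
      push_cast at h ⊢
      ring_nf at h ⊢
      linarith
    · have h := ih j
      simp only [oneWeight, ones_true, zeros_true, stepWeight]
      have key := inv_sub_inv_add_antitone (x := (j : ℝ) + ones v + 1)
        (y := (j : ℝ) + ones v + 1 + zeros v) (z := 1) (by positivity) (by simp) zero_le_one
      push_cast at h ⊢
      ring_nf at h key ⊢
      linarith

lemma level_bound_of_two_valleys (a b C : ℝ) (ha : 0 ≤ a) (hb : 0 ≤ b)
    (hC : 1 / (a + 1) + 1 / (b + 1) - 1 / (a + b + 1) ≤ C) :
    1 / (a + 2) + 1 / (b + 2) ≤ 4 / 3 * C := by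
  have h1 : 1 / (a + b + 1) ≤ 1 / 4 * (1 / (a + 1 / 2) + 1 / (b + 1 / 2)) := by
    have e : 1 / 4 * (1 / (a + 1 / 2) + 1 / (b + 1 / 2)) - 1 / (a + b + 1)
        = (a - b) ^ 2 / (4 * (a + 1 / 2) * (b + 1 / 2) * (a + b + 1)) := by
      field_simp
      ring
    have : 0 ≤ (a - b) ^ 2 / (4 * (a + 1 / 2) * (b + 1 / 2) * (a + b + 1)) := by positivity
    linarith
  have h2 : ∀ c : ℝ, 0 ≤ c → 1 / (c + 2) ≤ 4 / 3 * (1 / (c + 1)) - 1 / 3 * (1 / (c + 1 / 2)) := by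
    intro c hc
    have e : 4 / 3 * (1 / (c + 1)) - 1 / 3 * (1 / (c + 1 / 2)) - 1 / (c + 2)
        = (5 / 2 * c + 1 / 2) / (3 * (c + 1) * (c + 1 / 2) * (c + 2)) := by
      field_simp
      ring
    have : 0 ≤ (5 / 2 * c + 1 / 2) / (3 * (c + 1) * (c + 1 / 2) * (c + 2)) := by positivity
    linarith
  linarith [h2 a ha, h2 b hb]

lemma level_bound_of_three_valleys_aux (x y a b : ℝ) (hy : 1 ≤ y) (hyx : y ≤ x)
    (ha : 0 < a) (hb : x + 1 ≤ b) :
    0 ≤ 5 / 3 * (1 / (x + y + 1)) + (5 / 3 * (1 / a) - 8 / 3 * (1 / (a + x)))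
      + (5 / 3 * (1 / b) - 8 / 3 * (1 / (b + y))) := by
  have tangent : ∀ c z : ℝ, 0 < c → 0 < z →
      -(1 / 8 * (1 / z)) ≤ 5 / 3 * (1 / c) - 8 / 3 * (1 / (c + z)) := by
    intro c z hc hz
    have e : 5 / 3 * (1 / c) - 8 / 3 * (1 / (c + z)) + 1 / 8 * (1 / z)
        = (3 * (c - 7 / 2 * z) ^ 2 + 13 / 4 * z ^ 2) / (24 * c * z * (c + z)) := by
      field_simp
      ring
    have : 0 ≤ (3 * (c - 7 / 2 * z) ^ 2 + 13 / 4 * z ^ 2) / (24 * c * z * (c + z)) := by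
      positivity
    linarith
  have hx : 0 < x := by linarith
  have hb0 : 0 < b := by linarith
  have hA := tangent a x ha hx
  rcases le_total x (3 * y) with h | h
  · have hB := tangent b y hb0 (by linarith)
    have h1 : 1 / (3 * x) ≤ 1 / (x + y + 1) := one_div_le_one_div_of_le (by linarith) (by linarith)
    have h2 : 1 / y ≤ 3 * (1 / x) := by
      rw [mul_one_div, div_le_div_iff₀ (by linarith) hx]
      linarith
    have h3 : 1 / (3 * x) = 1 / 3 * (1 / x) := by field_simp
    have h4 : 0 < 1 / x := by positivity
    linarith
  · have hB : -(1 / (x + 1)) ≤ 5 / 3 * (1 / b) - 8 / 3 * (1 / (b + y)) := by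
      have h1 : 1 / (b + y) ≤ 1 / b := one_div_le_one_div_of_le hb0 (by linarith)
      have h2 : 1 / b ≤ 1 / (x + 1) := one_div_le_one_div_of_le (by linarith) hb
      linarith
    have h1 : 1 / (4 / 3 * x + 1) ≤ 1 / (x + y + 1) :=
      one_div_le_one_div_of_le (by linarith) (by linarith)
    have e : 5 / 3 * (1 / (4 / 3 * x + 1)) - 1 / 8 * (1 / x) - 1 / (x + 1)
        = (4 * x ^ 2 + 9 * x - 3) / (8 * x * (x + 1) * (4 * x + 3)) := by
      field_simp
      ring
    have : 0 ≤ (4 * x ^ 2 + 9 * x - 3) / (8 * x * (x + 1) * (4 * x + 3)) := by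
      apply div_nonneg
      · nlinarith
      · positivity
    linarith

lemma level_bound_of_three_valleys (x y a b C : ℝ) (hx : 1 ≤ x) (hy : 1 ≤ y)
    (ha : y ≤ a) (hb : x ≤ b)
    (hC : 1 / (x + y + 1) + (1 / (a + 1) - 1 / (a + x + 1)) + (1 / (b + 1) - 1 / (b + y + 1)) ≤ C) :
    1 / (a + 2) + 1 / (b + 2) + 1 / (x + y + 2) ≤ 8 / 3 * C := by
  have h1 : 1 / (a + 2) ≤ 1 / (a + 1) := one_div_le_one_div_of_le (by linarith) (by linarith)
  have h2 : 1 / (b + 2) ≤ 1 / (b + 1) := one_div_le_one_div_of_le (by linarith) (by linarith)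
  have h3 : 1 / (x + y + 2) ≤ 1 / (x + y + 1) :=
    one_div_le_one_div_of_le (by linarith) (by linarith)
  have e1 : a + 1 + x = a + x + 1 := by ring
  have e2 : b + 1 + y = b + y + 1 := by ring
  rcases le_total y x with h | h
  · have := level_bound_of_three_valleys_aux x y (a + 1) (b + 1) hy h (by linarith) (by linarith)
    rw [e1, e2] at this
    linarith
  · have := level_bound_of_three_valleys_aux y x (b + 1) (a + 1) hx h (by linarith) (by linarith)
    rw [e1, e2, add_comm y x] at this
    linarith

lemma take_getD_getD_drop (W : Word) (i : ℕ) (hi : i + 1 < W.length) :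
    W.take i ++ W.getD i true :: W.getD (i + 1) true :: W.drop (i + 2) = W := by
  rw [List.getD_eq_getElem _ _ hi, List.getD_eq_getElem _ _ (by omega),
    ← List.drop_eq_getElem_cons hi, ← List.drop_eq_getElem_cons, List.take_append_drop]

lemma take_succ_eq (W : Word) (i : ℕ) (hi : i < W.length) :
    W.take (i + 1) = W.take i ++ [W.getD i true] := by
  rw [List.getD_eq_getElem _ _ hi, List.take_append_getElem]

lemma drop_eq (W : Word) (i : ℕ) (hi : i < W.length) :
    W.drop i = W.getD i true :: W.drop (i + 1) := by
  rw [List.getD_eq_getElem _ _ hi, ← List.drop_eq_getElem_cons]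

lemma setPair_eq (W : Word) (i : ℕ) (hi : i + 1 < W.length) (x y : Bool) :
    setPair W i x y = W.take i ++ x :: y :: W.drop (i + 2) := by
  have h := setPair_append (W.take i) (W.drop (i + 2)) (W.getD i true) (W.getD (i + 1) true) x y
  rwa [take_getD_getD_drop W i hi, List.length_take_of_le (by omega)] at h

/-- The level of the boundary path of `W` after its first `i` letters. -/
def levelAt (W : Word) (i : ℕ) : ℕ := level (W.take i) (W.drop i)

lemma levelAt_succ (W : Word) (i : ℕ) (hi : i + 1 < W.length) :
    levelAt W (i + 1)
      = level (W.take i ++ [W.getD i true]) (W.getD (i + 1) true :: W.drop (i + 2)) := by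
  rw [levelAt, take_succ_eq W i (by omega), drop_eq W (i + 1) hi]

/-- The one-step drift of `phi1` when the pair `(i, i + 1)` of the word `W` is chosen. -/
noncomputable def pairDrift (β p : ℝ) (W : Word) (i : ℕ) : ℝ :=
  β / 2 * (phi1 (setPair W i false false) + phi1 (setPair W i true true) - 2 * phi1 W)
    + (1 - β) * (if W.getD i true then 1 - p else p) * (phi1 (swapPair W i) - phi1 W)

lemma pairDrift_valley (β p : ℝ) (W : Word) (i : ℕ) (hi : i + 1 < W.length)
    (h0 : W.getD i true = true) (h1 : W.getD (i + 1) true = false) :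
    pairDrift β p W i = β / 2 * (-invariant [] W + 1 / ((levelAt W (i + 1) : ℝ) + 1))
      + (1 - β) * (1 - p) * (1 / ((levelAt W (i + 1) : ℝ) + 2)) := by
  have hW := take_getD_getD_drop W i hi
  have hV := voter_increment_valley (W.take i) (W.drop (i + 2))
  have hE := exclusion_increment_valley (W.take i) (W.drop (i + 2))
  rw [h0, h1] at hW
  rw [hW] at hV hE
  rw [pairDrift, swapPair, levelAt_succ W i hi, h0, h1]
  simp only [setPair_eq W i hi, hV, hE, if_true]

lemma pairDrift_peak (β p : ℝ) (hβ1 : β ≤ 1) (hp0 : 0 ≤ p) (W : Word) (i : ℕ)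
    (hi : i + 1 < W.length) (h0 : W.getD i true = false) (h1 : W.getD (i + 1) true = true) :
    pairDrift β p W i ≤ β / 2 * (-invariant [] W - 1 / ((levelAt W (i + 1) : ℝ) + 1)) := by
  have hW := take_getD_getD_drop W i hi
  have hV := voter_increment_peak (W.take i) (W.drop (i + 2))
  have hE := exclusion_increment_valley (W.take i) (W.drop (i + 2))
  rw [h0, h1] at hW
  rw [hW] at hV hE
  have hpos : (0 : ℝ) ≤ 1 / ((level (W.take i ++ [true]) (false :: W.drop (i + 2)) : ℝ) + 2) := by
    positivity
  have hq : 0 ≤ (1 - β) * p := mul_nonneg (by linarith) hp0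
  rw [pairDrift, swapPair, levelAt_succ W i hi, h0, h1]
  simp only [setPair_eq W i hi, hV, Bool.false_eq_true, if_false]
  nlinarith

/-- The indicator of a `1`. -/
def oneIndicator (b : Bool) : ℝ := if b then 1 else 0

lemma sum_corners_level (W : Word) (m : ℕ) (hm : m ≤ W.length) :
    ∑ i ∈ Finset.range m, (oneIndicator (W.getD i true) - oneIndicator (W.getD (i + 1) true))
        * (1 / ((levelAt W (i + 1) : ℝ) + 1))
      = oneIndicator (W.getD 0 true) * (1 / ((levelAt W 0 : ℝ) + 1)) + oneWeight 0 W
        - oneIndicator (W.getD m true) * (1 / ((levelAt W m : ℝ) + 1))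
        - oneWeight (zeros (W.take m)) (W.drop m) := by
  induction m with
  | zero => simp
  | succ m ih =>
    rw [Finset.sum_range_succ, ih (by omega)]
    have h1 : oneWeight (zeros (W.take m)) (W.drop m)
        - oneWeight (zeros (W.take (m + 1))) (W.drop (m + 1))
        = oneIndicator (W.getD m true) * (1 / ((levelAt W (m + 1) : ℝ) + 1)
          - 1 / ((levelAt W m : ℝ) + 1)) := by
      rw [levelAt, levelAt, take_succ_eq W m hm, drop_eq W m hm]
      cases W.getD m true
      · simp [oneWeight, oneIndicator]
      · simp only [oneWeight, oneIndicator, level, stepWeight, zeros_append, zeros_true, zeros_nil,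
          ones_true]
        push_cast
        ring_nf
    linarith

lemma levelAt_pad (S : Word) (i : ℕ) (hi : i ≤ S.length) :
    levelAt (pad S) (i + 1) = levelAt S i := by
  simp [levelAt, level, pad, List.take_append_of_le_length hi, List.drop_append_of_le_length hi]

lemma ones_take_add_ones_drop (S : Word) (i : ℕ) :
    ones (S.take i) + ones (S.drop i) = ones S := by
  rw [← ones_append, List.take_append_drop]

lemma zeros_take_add_zeros_drop (S : Word) (i : ℕ) :
    zeros (S.take i) + zeros (S.drop i) = zeros S := by
  rw [← zeros_append, List.take_append_drop]

lemma invariant_lower_bound (S : Word) (i : ℕ) :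
    1 / ((zeros (S.take i) : ℝ) + ones (S.drop i) + 1)
      + (1 / ((ones S : ℝ) + 1) - 1 / ((ones S : ℝ) + zeros (S.take i) + 1))
      + (1 / ((zeros S : ℝ) + 1) - 1 / ((zeros S : ℝ) + ones (S.drop i) + 1))
      ≤ invariant [] S := by
  have h1 := zeroWeight_lower_bound 0 (S.take i) (ones (S.drop i))
  have h2 := oneWeight_lower_bound (zeros (S.take i)) (S.drop i)
  have h3 := invariant_eq (S.take i) (S.drop i)
  rw [List.take_append_drop] at h3
  rw [← h3, invariant, level, ← ones_take_add_ones_drop S i, ← zeros_take_add_zeros_drop S i]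
  push_cast at h1 ⊢
  rw [zero_add] at h1
  linarith

lemma one_div_levelAt_le_invariant (S : Word) (i : ℕ) :
    1 / ((levelAt S i : ℝ) + 1) ≤ invariant [] S := by
  refine le_trans ?_ (invariant_lower_bound S i)
  have h1 : 1 / ((ones S : ℝ) + zeros (S.take i) + 1) ≤ 1 / ((ones S : ℝ) + 1) :=
    one_div_le_one_div_of_le (by positivity) (by simp)
  have h2 : 1 / ((zeros S : ℝ) + ones (S.drop i) + 1) ≤ 1 / ((zeros S : ℝ) + 1) :=
    one_div_le_one_div_of_le (by positivity) (by simp)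
  rw [levelAt, level]
  push_cast
  linarith

lemma sum_valleys_le (S : Word) (h0 : S.getD 0 true = false)
    (h1 : S.getD (S.length - 1) false = true) (V : Finset ℕ)
    (hV : V ⊆ Finset.range (S.length + 1)) (h0V : 0 ∈ V) (hnV : S.length ∈ V) :
    ∑ i ∈ V, 1 / ((levelAt S i : ℝ) + 2) ≤ 4 / 3 * ((V.card : ℝ) - 1) * invariant [] S := by
  have hlen : 0 < S.length := by
    rcases S with _ | ⟨b, S⟩
    · simp at h0
    · simp
  have hsub : ({0, S.length} : Finset ℕ) ⊆ V := by
    simp [Finset.insert_subset_iff, h0V, hnV]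
  have hcard : ({0, S.length} : Finset ℕ).card = 2 := Finset.card_pair hlen.ne
  have hle : 2 ≤ V.card := hcard ▸ Finset.card_le_card hsub
  have hsum : ∑ i ∈ ({0, S.length} : Finset ℕ), 1 / ((levelAt S i : ℝ) + 2)
      = 1 / ((ones S : ℝ) + 2) + 1 / ((zeros S : ℝ) + 2) := by
    rw [Finset.sum_pair hlen.ne]
    simp [levelAt, level]
  rcases Nat.lt_or_ge 3 V.card with h4 | h3
  · have hC : 0 ≤ invariant [] S := le_trans (by positivity) (one_div_levelAt_le_invariant S 0)
    have hs : ∑ i ∈ V, 1 / ((levelAt S i : ℝ) + 2) ≤ V.card • invariant [] S :=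
      Finset.sum_le_card_nsmul _ _ _ fun i _ =>
        (one_div_le_one_div_of_le (by positivity) (by linarith)).trans
          (one_div_levelAt_le_invariant S i)
    rw [nsmul_eq_mul] at hs
    refine hs.trans (mul_le_mul_of_nonneg_right ?_ hC)
    have : (4 : ℝ) ≤ V.card := by exact_mod_cast h4
    linarith
  · rcases hle.eq_or_lt with h2 | h2
    · rw [← Finset.eq_of_subset_of_card_le hsub (by omega), hsum, hcard]
      have hb := level_bound_of_two_valleys (ones S) (zeros S) (invariant [] S)
        (by positivity) (by positivity) (by
          have := invariant_lower_bound S 0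
          simp only [List.take_zero, zeros_nil, List.drop_zero, Nat.cast_zero, zero_add,
            add_zero] at this
          rw [add_comm (zeros S : ℝ) (ones S : ℝ)] at this
          linarith)
      norm_num at hb ⊢
      linarith
    · have hc : (V \ {0, S.length}).card = 1 := by
        rw [Finset.card_sdiff_of_subset hsub]
        omega
      obtain ⟨k, hk⟩ := Finset.card_eq_one.mp hc
      have hkV : k ∈ V \ {0, S.length} := by simp [hk]
      simp only [Finset.mem_sdiff, Finset.mem_insert, Finset.mem_singleton, not_or] at hkV
      obtain ⟨hkV, hk0, hkn⟩ := hkV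
      have hkl : k < S.length := by
        have := Finset.mem_range.mp (hV hkV)
        omega
      rw [← Finset.sum_sdiff hsub, hk, hsum, Finset.sum_singleton,
        show V.card = 3 by omega, levelAt, level]
      have hx : 1 ≤ zeros (S.take k) := by
        obtain ⟨k, rfl⟩ := Nat.exists_eq_succ_of_ne_zero hk0
        rcases S with _ | ⟨b, S⟩
        · simp at hlen
        · simp only [List.getD_cons_zero] at h0
          simp [h0]
      have hy : 1 ≤ ones (S.drop k) := by
        refine List.one_le_count_iff.mpr ?_
        rw [List.getD_eq_getElem _ _ (by omega)] at h1
        rw [← h1]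
        refine List.mem_drop_iff_getElem.mpr ⟨S.length - 1 - k, by omega, ?_⟩
        congr 1
        omega
      have hb := level_bound_of_three_valleys (zeros (S.take k)) (ones (S.drop k)) (ones S)
        (zeros S) (invariant [] S) (by exact_mod_cast hx) (by exact_mod_cast hy)
        (by rw [← ones_take_add_ones_drop S k]; push_cast; simp)
        (by rw [← zeros_take_add_zeros_drop S k]; push_cast; simp)
        (invariant_lower_bound S k)
      push_cast
      linarith

/-- The left indices of the unlike adjacent pairs of the padded word. -/
def cornerSet (S : Word) : Finset ℕ :=
  (Finset.range (S.length + 1)).filter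
    (fun i => (pad S).getD i true ≠ (pad S).getD (i + 1) true)

lemma sum_map_unlike (S : Word) (f : ℕ → ℝ) :
    ((unlike S).map f).sum = ∑ i ∈ cornerSet S, f i := rfl

lemma hasSum_transition (φ : Word → ℝ) (c : ℝ) (x : Word) :
    HasSum (fun w => c * (if x = w then 1 else 0) * φ w) (c * φ x) := by
  convert hasSum_ite_eq x (c * φ x) using 2 with w
  by_cases h : w = x
  · simp [h]
  · simp [h, Ne.symm h]

lemma tsum_P_mul_phi1 (β p : ℝ) (S : Word) :
    ∑' S', P β p S S' * phi1 S'
      = ∑ i ∈ cornerSet S, ((cornerSet S).card : ℝ)⁻¹ * (phi1 S + pairDrift β p (pad S) i) := by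
  have hlen : (unlike S).length = (cornerSet S).card := rfl
  refine HasSum.tsum_eq ?_
  have key : ∀ i ∈ cornerSet S, HasSum (fun w' =>
      (let a := (pad S).getD i true
       let swapProb := if a then 1 - p else p
       ((unlike S).length : ℝ)⁻¹ *
        (β * (1 / 2) * (if strip (setPair (pad S) i false false) = w' then 1 else 0)
         + β * (1 / 2) * (if strip (setPair (pad S) i true true) = w' then 1 else 0)
         + (1 - β) * swapProb * (if strip (swapPair (pad S) i) = w' then 1 else 0)
         + (1 - β) * (1 - swapProb) * (if S = w' then 1 else 0))) * phi1 w')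
      (((cornerSet S).card : ℝ)⁻¹ * (phi1 S + pairDrift β p (pad S) i)) := by
    intro i _
    set s : ℝ := if (pad S).getD i true then 1 - p else p with hs
    set c : ℝ := ((cornerSet S).card : ℝ)⁻¹
    have h := (((hasSum_transition phi1 (c * (β * (1 / 2)))
        (strip (setPair (pad S) i false false))).add
      (hasSum_transition phi1 (c * (β * (1 / 2))) (strip (setPair (pad S) i true true)))).add
      (hasSum_transition phi1 (c * ((1 - β) * s)) (strip (swapPair (pad S) i)))).add
      (hasSum_transition phi1 (c * ((1 - β) * (1 - s))) S)
    convert h using 1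
    · funext w'
      simp only [← hs, hlen]
      ring
    · rw [pairDrift, ← hs, phi1_strip, phi1_strip, phi1_strip, phi1_pad]
      ring
  convert hasSum_sum key using 2 with w'
  rw [P, sum_map_unlike, Finset.sum_mul]

lemma sum_pairDrift_nonpos (β p : ℝ) (hβ : 4 / 7 ≤ β) (hβ1 : β ≤ 1) (hp0 : 0 ≤ p) (hp1 : p ≤ 1)
    (S : Word) (h0 : S.getD 0 true = false) (h1 : S.getD (S.length - 1) false = true) :
    ∑ i ∈ cornerSet S, pairDrift β p (pad S) i ≤ 0 := by
  have hlen : 0 < S.length := by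
    rcases S with _ | ⟨b, S⟩
    · simp at h0
    · simp
  have hpl : (pad S).length = S.length + 2 := by simp [pad]
  have hlast : (pad S).getD (S.length + 1) true = false := by simp [pad]
  set W := pad S with hW
  set V := (cornerSet S).filter (fun i => W.getD i true = true) with hVdef
  set C := invariant [] S with hC
  have hWC : invariant [] W = C := invariant_pad S
  set ε : ℕ → ℝ := fun i => oneIndicator (W.getD i true) - oneIndicator (W.getD (i + 1) true)
    with hε
  have hcorner : ∀ i, i ∈ cornerSet S ↔
      i < S.length + 1 ∧ W.getD i true ≠ W.getD (i + 1) true := by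
    intro i
    simp [cornerSet, hW]
  have hsupp : ∀ f : ℕ → ℝ, ∑ i ∈ Finset.range (S.length + 1), ε i * f i
      = ∑ i ∈ cornerSet S, ε i * f i := by
    intro f
    symm
    refine Finset.sum_subset (Finset.filter_subset _ _) fun i hi hi' => ?_
    have : W.getD i true = W.getD (i + 1) true := by
      by_contra h
      exact hi' ((hcorner i).mpr ⟨Finset.mem_range.mp hi, h⟩)
    simp only [hε, this, sub_self, zero_mul]
  have hsumε : ∑ i ∈ cornerSet S, ε i = 1 := by
    have h := hsupp fun _ => 1
    simp only [mul_one] at h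
    rw [← h, Finset.sum_range_sub', hlast]
    simp [hW, pad, oneIndicator]
  have hsumG : ∑ i ∈ cornerSet S, ε i * (1 / ((levelAt W (i + 1) : ℝ) + 1)) = C := by
    rw [← hsupp, sum_corners_level W (S.length + 1) (by omega), hlast, ← hWC,
      drop_eq W (S.length + 1) (by omega), hlast,
      List.drop_eq_nil_of_le (by omega : W.length ≤ S.length + 1 + 1)]
    simp [invariant, zeroWeight, oneWeight, oneIndicator, levelAt, hW, pad]
    ring
  have hcard : ((cornerSet S).card : ℝ) = 2 * V.card - 1 := by
    have hεV : ∀ i ∈ cornerSet S, ε i = 2 * (if W.getD i true = true then 1 else 0) - 1 := by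
      intro i hi
      have := ((hcorner i).mp hi).2
      simp only [hε]
      cases ha : W.getD i true <;> cases hb : W.getD (i + 1) true <;>
        (simp_all [oneIndicator]; try norm_num)
    rw [Finset.sum_congr rfl hεV, Finset.sum_sub_distrib, ← Finset.mul_sum, ← Finset.sum_filter,
      Finset.sum_const, Finset.sum_const, nsmul_eq_mul, nsmul_eq_mul] at hsumε
    rw [hVdef]
    linarith
  have hdrift : ∀ i ∈ cornerSet S, pairDrift β p W i ≤
      β / 2 * (-C + ε i * (1 / ((levelAt W (i + 1) : ℝ) + 1)))
        + (1 - β) * (1 - p) *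
          (if W.getD i true = true then 1 / ((levelAt S i : ℝ) + 2) else 0) := by
    intro i hi
    obtain ⟨hi, hne⟩ := (hcorner i).mp hi
    cases ha : W.getD i true
    · have hb : W.getD (i + 1) true = true := by
        rw [ha] at hne
        exact Bool.eq_true_of_not_eq_false hne.symm
      have h := pairDrift_peak β p hβ1 hp0 W i (by omega) ha hb
      rw [hWC] at h
      refine h.trans_eq ?_
      simp only [hε, ha, hb, oneIndicator, Bool.false_eq_true, if_true, if_false]
      ring
    · have hb : W.getD (i + 1) true = false := by
        rw [ha] at hne
        exact Bool.eq_false_of_not_eq_true hne.symm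
      rw [pairDrift_valley β p W i (by omega) ha hb, hWC, show levelAt W (i + 1) = levelAt S i from
        levelAt_pad S i (by omega)]
      refine le_of_eq ?_
      simp only [hε, ha, hb]
      simp [oneIndicator]
  refine (Finset.sum_le_sum hdrift).trans ?_
  rw [Finset.sum_add_distrib, ← Finset.mul_sum, ← Finset.mul_sum, ← Finset.sum_filter,
    Finset.sum_add_distrib, hsumG, Finset.sum_const, nsmul_eq_mul, hcard]
  have h0V : 0 ∈ V := by
    rw [hVdef, Finset.mem_filter, hcorner]
    rcases S with _ | ⟨b, S⟩
    · simp at hlen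
    · simp_all [pad]
  have hnV : S.length ∈ V := by
    have hl : W.getD S.length true = true := by
      obtain ⟨n, hn⟩ := Nat.exists_eq_succ_of_ne_zero hlen.ne'
      rw [hn, hW, pad, List.getD_cons_succ, List.getD_append _ _ _ _ (by omega)]
      rw [List.getD_eq_getElem _ _ (by omega)] at h1 ⊢
      simpa [hn] using h1
    rw [hVdef, Finset.mem_filter, hcorner, hl, hlast]
    simp
  have hVsub : V ⊆ Finset.range (S.length + 1) :=
    (Finset.filter_subset _ _).trans (Finset.filter_subset _ _)
  have hmain := sum_valleys_le S h0 h1 V hVsub h0V hnV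
  have hC0 : 0 ≤ C := le_trans (by positivity) (one_div_levelAt_le_invariant S 0)
  have hV1 : (1 : ℝ) ≤ V.card := by exact_mod_cast Finset.card_pos.mpr ⟨0, h0V⟩
  have hK : 0 ≤ ((V.card : ℝ) - 1) * C := mul_nonneg (by linarith) hC0
  have hq0 : 0 ≤ (1 - β) * (1 - p) := mul_nonneg (by linarith) (by linarith)
  have hq1 : (1 - β) * (1 - p) ≤ 3 / 7 := by nlinarith
  have h2 := mul_le_mul_of_nonneg_left hmain hq0
  have h3 := mul_le_mul_of_nonneg_right hq1 hK
  have h4 := mul_le_mul_of_nonneg_right hβ hK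
  rw [← hVdef]
  nlinarith

/-- Lemma 11 (supermartingale property of `φ₁`): if `β ≥ 4/7` and `p ∈ [0,1]`, then for
every `S ∈ 𝒟 ∖ {𝒟₀}` the one-step expected increment of `φ₁` is nonpositive:
`Σ_{S'} P(S,S') φ₁(S') ≤ φ₁(S)`. -/
theorem phi1_supermartingale
    (β : ℝ) (hβ : 4 / 7 ≤ β) (hβ1 : β ≤ 1)
    (p : ℝ) (hp0 : 0 ≤ p) (hp1 : p ≤ 1)
    (S : Word) (hS : IsConfig S) (hne : S ≠ groundState) :
    (∑' S' : Word, P β p S S' * phi1 S') ≤ phi1 S := by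
  have hS' : S.head? = some false ∧ S.getLast? = some true := hS.resolve_left hne
  have h0 : S.getD 0 true = false := by
    rw [List.getD_eq_getElem?_getD, ← List.head?_eq_getElem?, hS'.1, Option.getD_some]
  have h1 : S.getD (S.length - 1) false = true := by
    rw [List.getD_eq_getElem?_getD, ← List.getLast?_eq_getElem?, hS'.2, Option.getD_some]
  have hdrift := sum_pairDrift_nonpos β p hβ hβ1 hp0 hp1 S h0 h1
  rw [tsum_P_mul_phi1, ← Finset.mul_sum, Finset.sum_add_distrib, Finset.sum_const, nsmul_eq_mul,
    mul_add]
  have hinv : (0 : ℝ) ≤ ((cornerSet S).card : ℝ)⁻¹ := by positivity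
  have hpos : ((cornerSet S).card : ℝ) ≠ 0 := by
    rw [Nat.cast_ne_zero, Finset.card_ne_zero]
    refine ⟨0, ?_⟩
    rcases S with _ | ⟨b, S⟩
    · simp at h0
    · simp_all [cornerSet, pad]
  rw [inv_mul_cancel_left₀ hpos]
  linarith [mul_nonpos_of_nonneg_of_nonpos hinv hdrift]

end EV
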